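/- arXiv:2405.11550 — 4 statements merged into one kernel-verified Lean document; each statement's English description precedes it below -/
import Mathlib

section
/- Let V be a finite set and let f : Finset V → ℝ be a set function that is normalized (f(∅) = 0), monotone (A ⊆ B implies f(A) ≤ f(B)), and submodular (for all A ⊆ B ⊆ V and e ∈ V \ B, f(A ∪ {e}) − f(A) ≥ f(B ∪ {e}) − f(B)). Let K ≥ 1 and let S₀ = ∅, S_{i+1} = S_i ∪ {e_i} be a greedy sequence, where at each step e_i is an element of V maximizing f(S_i ∪ {e}) over all e ∈ V. Then for every S⋆ ⊆ V with |S⋆| ≤ K, f(S_K) ≥ (1 − 1/e) · f(S⋆), where e is Euler's number. -/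
/-- If every element of `T` has marginal value at most `m` over `A`, then adding all of `T` to `A`
increases a submodular function by at most `#T * m`. -/
theorem apply_union_le_of_marginal_le {V : Type*} [DecidableEq V] {f : Finset V → ℝ}
    (hsub : ∀ A B : Finset V, A ⊆ B → ∀ e ∉ B,
      f (insert e B) - f B ≤ f (insert e A) - f A)
    (A T : Finset V) {m : ℝ} (hm : ∀ e ∈ T, f (insert e A) - f A ≤ m) :
    f (A ∪ T) ≤ f A + T.card * m := by
  induction T using Finset.induction_on with
  | empty => simp
  | insert e T he ih =>
    have ih := ih fun x hx => hm x (Finset.mem_insert_of_mem hx)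
    have hme := hm e (Finset.mem_insert_self e T)
    have hstep : f (insert e (A ∪ T)) - f (A ∪ T) ≤ m := by
      by_cases hA : e ∈ A
      · rw [Finset.insert_eq_of_mem hA] at hme
        rw [Finset.insert_eq_of_mem (Finset.mem_union_left T hA)]
        linarith
      · exact (hsub A (A ∪ T) Finset.subset_union_left e (by simp [hA, he])).trans hme
    rw [Finset.union_insert, Finset.card_insert_of_notMem he]
    push_cast
    linarith

/-- Greedy maximization of a normalized, monotone, submodular set function over a finite
ground set achieves at least a `(1 - 1/e)` fraction of the optimal value under a
cardinality budget `K`. -/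
theorem greedy_nms_suboptimality_bound {V : Type*} [Fintype V] [DecidableEq V]
    (f : Finset V → ℝ)
    (hnorm : f ∅ = 0)
    (hmono : ∀ A B : Finset V, A ⊆ B → f A ≤ f B)
    (hsub : ∀ A B : Finset V, A ⊆ B → ∀ e ∉ B,
      f (insert e B) - f B ≤ f (insert e A) - f A)
    (K : ℕ) (hK : 1 ≤ K)
    (S : ℕ → Finset V)
    (hS0 : S 0 = ∅)
    (hgreedy : ∀ i : ℕ, ∃ e : V, S (i + 1) = insert e (S i) ∧
      ∀ e' : V, f (insert e' (S i)) ≤ f (insert e (S i)))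
    (Sstar : Finset V) (hcard : Sstar.card ≤ K) :
    (1 - 1 / Real.exp 1) * f Sstar ≤ f (S K) := by
  have hK0 : (0 : ℝ) < K := by exact_mod_cast hK
  have hcard' : (Sstar.card : ℝ) ≤ K := by exact_mod_cast hcard
  have hratio : (0 : ℝ) ≤ 1 - 1 / K := by
    rw [sub_nonneg, div_le_one hK0]
    exact_mod_cast hK
  have hopt : 0 ≤ f Sstar := hnorm ▸ hmono ∅ Sstar (Finset.empty_subset _)
  have hstep (i : ℕ) : f Sstar - f (S (i + 1)) ≤ (1 - 1 / K) * (f Sstar - f (S i)) := by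
    obtain ⟨e, he, hmax⟩ := hgreedy i
    have hunion := apply_union_le_of_marginal_le hsub (S i) Sstar
      (fun x _ => sub_le_sub_right (hmax x) (f (S i)))
    rw [← he] at hunion
    have hle := hmono Sstar (S i ∪ Sstar) Finset.subset_union_right
    have hgain : 0 ≤ f (S (i + 1)) - f (S i) :=
      sub_nonneg.2 (hmono _ _ (he ▸ Finset.subset_insert e (S i)))
    have hgap : (f Sstar - f (S i)) / K ≤ f (S (i + 1)) - f (S i) := by
      rw [div_le_iff₀ hK0]
      linarith [mul_le_mul_of_nonneg_right hcard' hgain]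
    linear_combination hgap
  have hpow (i : ℕ) : f Sstar - f (S i) ≤ (1 - 1 / K) ^ i * f Sstar := by
    induction i with
    | zero => simp [hS0, hnorm]
    | succ i ih =>
      rw [pow_succ', mul_assoc]
      exact (hstep i).trans (mul_le_mul_of_nonneg_left ih hratio)
  have hexp : (1 - 1 / K : ℝ) ^ K ≤ 1 / Real.exp 1 := by
    rw [one_div (Real.exp 1), ← Real.exp_neg]
    exact Real.one_sub_div_pow_le_exp_neg (by exact_mod_cast hK)
  linarith [hpow K, mul_le_mul_of_nonneg_right hexp hopt]
end

section
/- Let V be a finite set and let f : Finset V → ℝ be monotone and submodular. Let K ≥ 1 and let S⋆ ⊆ V satisfy |S⋆| ≤ K. Then for every S ⊆ V, the maximum over e ∈ V of the marginal gain f(S ∪ {e}) − f(S) is at least (f(S⋆) − f(S)) / K. -/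
/-- The gain of a monotone submodular function from adding a set `T` to `S` is at most the sum
of the marginal gains at `S` of the elements of `T`. -/
theorem submodular_union_sub_le_sum {V : Type*} [DecidableEq V] (f : Finset V → ℝ)
    (hmono : ∀ A B : Finset V, A ⊆ B → f A ≤ f B)
    (hsub : ∀ A B : Finset V, A ⊆ B → ∀ e ∉ B,
      f (insert e B) - f B ≤ f (insert e A) - f A)
    (S T : Finset V) :
    f (S ∪ T) - f S ≤ ∑ e ∈ T, (f (insert e S) - f S) := by
  induction T using Finset.induction_on with
  | empty => simp
  | insert e T he ih =>
    rw [Finset.sum_insert he, Finset.union_insert]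
    by_cases h : e ∈ S ∪ T
    · rw [Finset.insert_eq_of_mem h]
      linarith [hmono S (insert e S) (Finset.subset_insert e S)]
    · linarith [hsub S (S ∪ T) Finset.subset_union_left e h]


/-- For a monotone submodular set function `f` on a finite nonempty ground set, and any
`Sstar` with `|Sstar| ≤ K`, the best single-element marginal gain at any set `S` is at
least `(f Sstar - f S) / K`. -/
theorem greedy_marginal_gain_bound {V : Type*} [Fintype V] [DecidableEq V] [Nonempty V]
    (f : Finset V → ℝ)
    (hmono : ∀ A B : Finset V, A ⊆ B → f A ≤ f B)
    (hsub : ∀ A B : Finset V, A ⊆ B → ∀ e ∉ B,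
      f (insert e B) - f B ≤ f (insert e A) - f A)
    (K : ℕ) (hK : 1 ≤ K)
    (Sstar : Finset V) (hcard : Sstar.card ≤ K)
    (S : Finset V) :
    (f Sstar - f S) / K ≤ Finset.univ.sup' Finset.univ_nonempty
      (fun e : V => f (insert e S) - f S) := by
  set M := Finset.univ.sup' Finset.univ_nonempty (fun e : V => f (insert e S) - f S)
  have hM : ∀ e : V, f (insert e S) - f S ≤ M := fun e =>
    Finset.le_sup' (fun e : V => f (insert e S) - f S) (Finset.mem_univ e)
  have hM0 : 0 ≤ M := by
    obtain ⟨e⟩ := ‹Nonempty V›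
    linarith [hM e, hmono S (insert e S) (Finset.subset_insert e S)]
  have hK0 : (0 : ℝ) < K := by exact_mod_cast hK
  rw [div_le_iff₀ hK0]
  calc f Sstar - f S ≤ f (S ∪ Sstar) - f S :=
        sub_le_sub_right (hmono _ _ Finset.subset_union_right) _
    _ ≤ ∑ e ∈ Sstar, (f (insert e S) - f S) := submodular_union_sub_le_sum f hmono hsub S Sstar
    _ ≤ Sstar.card • M := Finset.sum_le_card_nsmul _ _ _ fun e _ => hM e
    _ = M * Sstar.card := by rw [nsmul_eq_mul, mul_comm]
    _ ≤ M * K := by gcongr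
end

section
/- Let V be a finite index set, let n ≥ 1, let v : V → ℝⁿ be a family of vectors, and let M₀ be a symmetric positive definite n × n real matrix. Define the set function F(S) = log det(M₀ + Σ_{j ∈ S} v_j v_jᵀ) for S ⊆ V. Then F is submodular: for all A ⊆ B ⊆ V and e ∈ V \ B, F(A ∪ {e}) − F(A) ≥ F(B ∪ {e}) − F(B). -/
open Matrix

/-- The matrix determinant lemma, for a symmetric rank-one update. -/
theorem det_add_vecMulVec_self {ι : Type*} [Fintype ι] [DecidableEq ι]
    {X : Matrix ι ι ℝ} (hX : IsUnit X.det) (u : ι → ℝ) :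
    (X + vecMulVec u u).det = X.det * (1 + u ⬝ᵥ (X⁻¹ *ᵥ u)) := by
  rw [vecMulVec_eq Unit, det_add_replicateCol_mul_replicateRow hX, Matrix.mul_assoc,
    ← replicateCol_mulVec, det_unique (n := Unit), Matrix.add_apply, one_apply_eq,
    replicateRow_mul_replicateCol_apply]

/-- The quadratic form of the inverse is antitone in the Loewner order. -/
theorem dotProduct_inv_add_mulVec_le {ι : Type*} [Fintype ι] [DecidableEq ι]
    {X P : Matrix ι ι ℝ} (hX : X.PosDef) (hP : P.PosSemidef) (u : ι → ℝ) :
    u ⬝ᵥ ((X + P)⁻¹ *ᵥ u) ≤ u ⬝ᵥ (X⁻¹ *ᵥ u) := by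
  have hXu : IsUnit X.det := hX.det_pos.ne'.isUnit
  have hYu : IsUnit (X + P).det := (hX.add_posSemidef hP).det_pos.ne'.isUnit
  set x := X⁻¹ *ᵥ u with hx
  set y := (X + P)⁻¹ *ᵥ u with hy
  have hXx : X *ᵥ x = u := by rw [hx, mulVec_mulVec, mul_nonsing_inv _ hXu, one_mulVec]
  have hXy : X *ᵥ y + P *ᵥ y = u := by
    rw [← add_mulVec, hy, mulVec_mulVec, mul_nonsing_inv _ hYu, one_mulVec]
  have hsymm : x ⬝ᵥ (X *ᵥ y) = u ⬝ᵥ y := by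
    have hT : Xᵀ = X := by simpa using hX.isHermitian.eq
    rw [dotProduct_mulVec, ← mulVec_transpose, hT, hXx]
  have h₁ : 0 ≤ (x - y) ⬝ᵥ (X *ᵥ (x - y)) := by
    simpa using hX.posSemidef.dotProduct_mulVec_nonneg (x - y)
  have h₂ : 0 ≤ y ⬝ᵥ (P *ᵥ y) := by simpa using hP.dotProduct_mulVec_nonneg y
  have h₃ : y ⬝ᵥ (X *ᵥ y) + y ⬝ᵥ (P *ᵥ y) = u ⬝ᵥ y := by
    rw [← dotProduct_add, hXy, dotProduct_comm]
  rw [mulVec_sub, hXx, sub_dotProduct, dotProduct_sub, dotProduct_sub, hsymm,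
    dotProduct_comm x u, dotProduct_comm y u] at h₁
  linarith

/-- The log-determinant gain of a rank-one update of a positive definite matrix. -/
theorem log_det_add_vecMulVec_sub {ι : Type*} [Fintype ι] [DecidableEq ι]
    {X : Matrix ι ι ℝ} (hX : X.PosDef) (u : ι → ℝ) :
    Real.log (X + vecMulVec u u).det - Real.log X.det =
      Real.log (1 + u ⬝ᵥ (X⁻¹ *ᵥ u)) := by
  have h : 0 ≤ u ⬝ᵥ (X⁻¹ *ᵥ u) := by
    simpa using hX.inv.posSemidef.dotProduct_mulVec_nonneg u
  rw [det_add_vecMulVec_self hX.det_pos.ne'.isUnit,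
    Real.log_mul hX.det_pos.ne' (by positivity), add_sub_cancel_left]

theorem posSemidef_sum_vecMulVec_self {ι κ : Type*} [Fintype ι] (v : κ → ι → ℝ)
    (S : Finset κ) : (∑ j ∈ S, vecMulVec (v j) (v j)).PosSemidef :=
  posSemidef_sum S fun j _ => by simpa using posSemidef_vecMulVec_self_star (v j)

/-- The log-determinant objective `F S = log det (M₀ + Σ_{j ∈ S} vⱼ vⱼᵀ)` with
symmetric positive definite `M₀` is a submodular set function. -/
theorem logdet_set_function_submodular {V : Type*} [Fintype V] [DecidableEq V]
    (n : ℕ) (hn : 1 ≤ n)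
    (v : V → (Fin n → ℝ))
    (M₀ : Matrix (Fin n) (Fin n) ℝ) (hM₀sym : M₀.IsSymm) (hM₀ : M₀.PosDef)
    (F : Finset V → ℝ)
    (hF : ∀ S : Finset V,
      F S = Real.log (M₀ + ∑ j ∈ S, Matrix.vecMulVec (v j) (v j)).det)
    (A B : Finset V) (hAB : A ⊆ B) (e : V) (he : e ∉ B) :
    F (insert e B) - F B ≤ F (insert e A) - F A := by
  have hpos (S : Finset V) : (M₀ + ∑ j ∈ S, vecMulVec (v j) (v j)).PosDef :=
    hM₀.add_posSemidef (posSemidef_sum_vecMulVec_self v S)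
  have hgain (S : Finset V) (hS : e ∉ S) : F (insert e S) - F S =
      Real.log (1 + v e ⬝ᵥ ((M₀ + ∑ j ∈ S, vecMulVec (v j) (v j))⁻¹ *ᵥ v e)) := by
    rw [hF, hF, Finset.sum_insert hS, add_comm (vecMulVec _ _), ← add_assoc,
      log_det_add_vecMulVec_sub (hpos S)]
  have hnonneg : 0 ≤ v e ⬝ᵥ ((M₀ + ∑ j ∈ B, vecMulVec (v j) (v j))⁻¹ *ᵥ v e) := by
    simpa using (hpos B).inv.posSemidef.dotProduct_mulVec_nonneg (v e)
  have hle := dotProduct_inv_add_mulVec_le (hpos A)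
    (posSemidef_sum_vecMulVec_self v (B \ A)) (v e)
  rw [add_assoc, add_comm (∑ j ∈ A, _), Finset.sum_sdiff hAB] at hle
  rw [hgain B he, hgain A fun h => he (hAB h)]
  exact Real.log_le_log (by positivity) (by linarith)
end

section
/- Let V be a finite index set, let n ≥ 1, let v : V → ℝⁿ, and let M₀ be a symmetric positive definite n × n real matrix. Define F_NMS(S) = log det(M₀ + Σ_{j ∈ S} v_j v_jᵀ) − log det(M₀). Let K ≥ 1 and let S_g be the set produced by K steps of the greedy algorithm applied to F_NMS (starting from ∅ and at each step adding an element of V maximizing the value of F_NMS on the augmented set). Then for every S⋆ ⊆ V with |S⋆| ≤ K, F_NMS(S_g) ≥ (1 − 1/e) · F_NMS(S⋆), where e is Euler's number. -/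
open Matrix

section Greedy

variable {V : Type*} [DecidableEq V] {F : Finset V → ℝ}

/-- For a set function with diminishing returns, the gain of adding a whole set is at most the sum
of the gains of its elements. -/
theorem sub_le_sum_marginal_of_diminishing
    (hsub : ∀ S T : Finset V, S ⊆ T → ∀ e : V, F (insert e T) - F T ≤ F (insert e S) - F S)
    (S T : Finset V) : F (T ∪ S) - F S ≤ ∑ e ∈ T, (F (insert e S) - F S) := by
  induction T using Finset.induction_on with
  | empty => simp
  | insert a T ha ih =>
    rw [Finset.sum_insert ha, Finset.insert_union]
    linarith [hsub S (T ∪ S) Finset.subset_union_right a]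

/-- The **Nemhauser–Wolsey–Fisher bound**: greedy maximization of a normalized monotone set
function with diminishing returns achieves a `1 - 1/e` fraction of the optimum. -/
theorem greedy_bound_of_monotone_of_diminishing (hF0 : F ∅ = 0) (hmono : Monotone F)
    (hsub : ∀ S T : Finset V, S ⊆ T → ∀ e : V, F (insert e T) - F T ≤ F (insert e S) - F S)
    {S : ℕ → Finset V} (hS0 : S 0 = ∅)
    (hgreedy : ∀ i e, F (insert e (S i)) ≤ F (S (i + 1)))
    {K : ℕ} (hK : 1 ≤ K) {T : Finset V} (hT : T.card ≤ K) :
    (1 - 1 / Real.exp 1) * F T ≤ F (S K) := by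
  have hK1 : (1 : ℝ) ≤ K := by exact_mod_cast hK
  have hK0 : (0 : ℝ) < K := by linarith
  have hT0 : 0 ≤ F T := hF0 ▸ hmono T.empty_subset
  have hstep (i : ℕ) : F T - F (S (i + 1)) ≤ (1 - 1 / K) * (F T - F (S i)) := by
    have hcover : F T ≤ F (T ∪ S i) := hmono Finset.subset_union_left
    have hgain : F (T ∪ S i) - F (S i) ≤ T.card * (F (S (i + 1)) - F (S i)) := by
      refine (sub_le_sum_marginal_of_diminishing hsub (S i) T).trans ?_
      rw [← nsmul_eq_mul]
      exact Finset.sum_le_card_nsmul _ _ _ fun e _ => sub_le_sub_right (hgreedy i e) _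
    have hcard : (T.card : ℝ) * (F (S (i + 1)) - F (S i)) ≤ K * (F (S (i + 1)) - F (S i)) := by
      obtain hV | ⟨⟨a⟩⟩ := isEmpty_or_nonempty V
      · simp [Finset.eq_empty_of_isEmpty (S _)]
      · have := (hmono (Finset.subset_insert a (S i))).trans (hgreedy i a)
        gcongr
    have hdiv : (F T - F (S i)) / K ≤ F (S (i + 1)) - F (S i) := by
      rw [div_le_iff₀' hK0]
      linarith
    linear_combination hdiv
  have hgap (i : ℕ) : F T - F (S i) ≤ (1 - 1 / K) ^ i * F T := by
    induction i with
    | zero => simp [hS0, hF0]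
    | succ i ih =>
      have hnonneg : (0 : ℝ) ≤ 1 - 1 / K := sub_nonneg.2 ((div_le_one hK0).2 hK1)
      calc F T - F (S (i + 1)) ≤ (1 - 1 / K) * (F T - F (S i)) := hstep i
        _ ≤ (1 - 1 / K) * ((1 - 1 / K) ^ i * F T) := by gcongr
        _ = (1 - 1 / K) ^ (i + 1) * F T := by ring
  have hexp : (1 - 1 / (K : ℝ)) ^ K ≤ 1 / Real.exp 1 := by
    simpa [Real.exp_neg] using Real.one_sub_div_pow_le_exp_neg hK1
  linarith [hgap K, mul_le_mul_of_nonneg_right hexp hT0]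

end Greedy

section LogDet

variable {m : Type*} [Fintype m]

theorem Matrix.posSemidef_vecMulVec_self (v : m → ℝ) : (vecMulVec v v).PosSemidef := by
  simpa using posSemidef_vecMulVec_self_star v

variable [DecidableEq m]

theorem Matrix.det_add_vecMulVec {R : Type*} [CommRing R] {A : Matrix m m R} (hA : IsUnit A.det)
    (u v : m → R) : (A + vecMulVec u v).det = A.det * (1 + v ⬝ᵥ A⁻¹ *ᵥ u) := by
  rw [vecMulVec_eq Unit, det_add_replicateCol_mul_replicateRow hA,
    det_unique (n := Unit)]
  simp [Matrix.mul_assoc, Matrix.mul_apply, dotProduct, mulVec]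

/-- Inversion of positive definite matrices is antitone in the Loewner order. -/
theorem Matrix.PosDef.dotProduct_inv_add_mulVec_le {A C : Matrix m m ℝ} (hA : A.PosDef)
    (hC : C.PosSemidef) (v : m → ℝ) :
    v ⬝ᵥ (A + C)⁻¹ *ᵥ v ≤ v ⬝ᵥ A⁻¹ *ᵥ v := by
  have hB := hA.add_posSemidef hC
  set x := (A + C)⁻¹ *ᵥ v with hx
  set y := A⁻¹ *ᵥ v with hy
  have hBx : (A + C) *ᵥ x = v := by
    rw [hx, mulVec_mulVec, mul_nonsing_inv _ ((isUnit_iff_isUnit_det _).1 hB.isUnit), one_mulVec]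
  have hAy : A *ᵥ y = v := by
    rw [hy, mulVec_mulVec, mul_nonsing_inv _ ((isUnit_iff_isUnit_det _).1 hA.isUnit), one_mulVec]
  have hsymm : y ⬝ᵥ A *ᵥ x = v ⬝ᵥ x := by
    have hAT : Aᵀ = A := by simpa using hA.isHermitian.eq
    rw [dotProduct_mulVec, ← mulVec_transpose, hAT, hAy]
  have hAyx : 0 ≤ (y - x) ⬝ᵥ A *ᵥ (y - x) := by
    simpa using hA.posSemidef.dotProduct_mulVec_nonneg (y - x)
  have hCx : 0 ≤ x ⬝ᵥ C *ᵥ x := by simpa using hC.dotProduct_mulVec_nonneg x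
  have hBxx : x ⬝ᵥ A *ᵥ x + x ⬝ᵥ C *ᵥ x = v ⬝ᵥ x := by
    rw [← dotProduct_add, ← add_mulVec, hBx, dotProduct_comm]
  rw [mulVec_sub, dotProduct_sub, sub_dotProduct, sub_dotProduct, hAy, hsymm,
    dotProduct_comm y v, dotProduct_comm x v] at hAyx
  linarith

/-- The increment of `log det` under a positive semidefinite rank-one update. -/
theorem Matrix.PosDef.log_det_add_vecMulVec {A : Matrix m m ℝ} (hA : A.PosDef) (v : m → ℝ) :
    Real.log (A + vecMulVec v v).det = Real.log A.det + Real.log (1 + v ⬝ᵥ A⁻¹ *ᵥ v) := by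
  have hq : 0 ≤ v ⬝ᵥ A⁻¹ *ᵥ v := by
    simpa using hA.inv.posSemidef.dotProduct_mulVec_nonneg v
  rw [det_add_vecMulVec ((isUnit_iff_isUnit_det _).1 hA.isUnit),
    Real.log_mul hA.det_pos.ne' (by positivity)]

end LogDet

/-- Greedy maximization of the normalized log-determinant objective
`F_NMS S = log det (M₀ + Σ_{j ∈ S} vⱼ vⱼᵀ) - log det M₀` under a cardinality budget `K`
achieves at least a `(1 - 1/e)` fraction of the optimal value. -/
theorem greedy_logdet_suboptimality_bound {V : Type*} [Fintype V] [DecidableEq V]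
    (n : ℕ) (hn : 1 ≤ n)
    (v : V → (Fin n → ℝ))
    (M₀ : Matrix (Fin n) (Fin n) ℝ) (hM₀sym : M₀.IsSymm) (hM₀ : M₀.PosDef)
    (F : Finset V → ℝ)
    (hF : ∀ S : Finset V,
      F S = Real.log (M₀ + ∑ j ∈ S, Matrix.vecMulVec (v j) (v j)).det
          - Real.log M₀.det)
    (K : ℕ) (hK : 1 ≤ K)
    (S : ℕ → Finset V)
    (hS0 : S 0 = ∅)
    (hgreedy : ∀ i : ℕ, ∃ e : V, S (i + 1) = insert e (S i) ∧
      ∀ e' : V, F (insert e' (S i)) ≤ F (insert e (S i))) :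
    ∀ Sstar : Finset V, Sstar.card ≤ K →
      (1 - 1 / Real.exp 1) * F Sstar ≤ F (S K) := by
  intro Sstar hcard
  have hsum (S : Finset V) : (∑ j ∈ S, vecMulVec (v j) (v j)).PosSemidef :=
    posSemidef_sum S fun j _ => posSemidef_vecMulVec_self (v j)
  have hpos (S : Finset V) : (M₀ + ∑ j ∈ S, vecMulVec (v j) (v j)).PosDef :=
    hM₀.add_posSemidef (hsum S)
  have hgain (S : Finset V) (e : V) (he : e ∉ S) : F (insert e S) - F S =
      Real.log (1 + v e ⬝ᵥ (M₀ + ∑ j ∈ S, vecMulVec (v j) (v j))⁻¹ *ᵥ v e) := by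
    rw [hF, hF, Finset.sum_insert he, add_comm (vecMulVec (v e) (v e)), ← add_assoc,
      (hpos S).log_det_add_vecMulVec]
    ring
  have hquad (S : Finset V) (e : V) :
      0 ≤ v e ⬝ᵥ (M₀ + ∑ j ∈ S, vecMulVec (v j) (v j))⁻¹ *ᵥ v e := by
    simpa using (hpos S).inv.posSemidef.dotProduct_mulVec_nonneg (v e)
  have hinsert (S : Finset V) (e : V) : F S ≤ F (insert e S) := by
    by_cases he : e ∈ S
    · rw [Finset.insert_eq_of_mem he]
    · rw [← sub_nonneg, hgain S e he]
      exact Real.log_nonneg (le_add_of_nonneg_right (hquad S e))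
  have hmono : Monotone F := by
    intro A B hAB
    rw [← Finset.sdiff_union_of_subset hAB]
    induction B \ A using Finset.induction_on with
    | empty => simp
    | insert a T _ ih => exact ih.trans (Finset.insert_union a T A ▸ hinsert _ a)
  refine greedy_bound_of_monotone_of_diminishing (by simp [hF]) hmono ?_ hS0 ?_ hK hcard
  · intro A B hAB e
    by_cases he : e ∈ B
    · rw [Finset.insert_eq_of_mem he, sub_self]
      exact sub_nonneg.2 (hinsert A e)
    · rw [hgain B e he, hgain A e fun h => he (hAB h)]
      have hle := (hpos A).dotProduct_inv_add_mulVec_le (hsum (B \ A)) (v e)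
      rw [add_assoc, add_comm (∑ j ∈ A, _), Finset.sum_sdiff hAB] at hle
      have := hquad B e
      gcongr
  · intro i e
    obtain ⟨a, ha, hmax⟩ := hgreedy i
    exact ha ▸ hmax e
end
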